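/- arXiv:1909.02546 — 2 statements merged into one kernel-verified Lean document; each statement's English description precedes it below -/
import Mathlib

section
/- Let W be a standard Brownian motion and let B(t) = W(t) − t W(1) for t ∈ [0,1] be the standard Brownian bridge. For θ > 0, with B̄ = ∫_0^1 B(u) du, one has E[ exp( −(θ²/2) ∫_0^1 (B(u) − B̄)² du ) ] = θ / ( 2 sinh(θ/2) ). -/
open MeasureTheory ProbabilityTheory Filter

/-- `W` is a standard Brownian motion under `P`: it is measurable in `ω` for each time,
has continuous paths on `[0,∞)`, starts at `0`, and every finite linear combination
`∑ i, c i * W (t i)` with times `t i ≥ 0` is a centered Gaussian with variance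
`∑ i, ∑ j, c i * c j * min (t i) (t j)` (i.e. `W` is a centered Gaussian process with
covariance `Cov(W s, W t) = min s t`). -/
def IsStdBM {Ω : Type*} [MeasurableSpace Ω] (P : Measure Ω) (W : ℝ → Ω → ℝ) : Prop :=
  (∀ t : ℝ, Measurable (W t)) ∧
  (∀ ω, ContinuousOn (fun t => W t ω) (Set.Ici 0)) ∧
  (∀ ω, W 0 ω = 0) ∧
  ∀ (n : ℕ) (t : Fin n → ℝ) (c : Fin n → ℝ), (∀ i, 0 ≤ t i) →
    P.map (fun ω => ∑ i, c i * W (t i) ω) =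
      gaussianReal 0 (∑ i, ∑ j, c i * c j * min (t i) (t j)).toNNReal

open scoped Topology

/-- Left Riemann sums over the uniform partition of `[0, 1]` converge for bounded, almost everywhere
continuous functions. -/
lemma tendsto_sum_div_integral {f : ℝ → ℝ} {C : ℝ} (hC : ∀ u ∈ Set.Icc (0 : ℝ) 1, |f u| ≤ C)
    (hf : ∀ᵐ u : ℝ, u ∈ Set.Ioo (0 : ℝ) 1 → ContinuousAt f u) :
    Tendsto (fun n : ℕ => ∑ j ∈ Finset.range n, f (j / n) / n) atTop
      (𝓝 (∫ u in (0 : ℝ)..1, f u)) := by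
  have key : ∀ n : ℕ, 0 < n → ∑ j ∈ Finset.range n, f (j / n) / n =
      ∫ u in (0 : ℝ)..1, f (⌊u * n⌋₊ / n) := by
    intro n hn
    have hn' : (0 : ℝ) < n := by exact_mod_cast hn
    have hcongr : ∀ j : ℕ, Set.EqOn (fun u : ℝ => f (⌊u * n⌋₊ / n)) (fun _ => f (j / n))
        (Set.Ioo ((j : ℝ) / n) (((j + 1 : ℕ) : ℝ) / n)) := by
      intro j u hu
      have h1 : (j : ℝ) ≤ u * n := ((div_lt_iff₀ hn').1 hu.1).le
      have h2 : u * n < (j : ℝ) + 1 := by exact_mod_cast (lt_div_iff₀ hn').1 hu.2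
      have : ⌊u * n⌋₊ = j := (Nat.floor_eq_iff ((Nat.cast_nonneg j).trans h1)).2 ⟨h1, h2⟩
      simp [this]
    have hle : ∀ j : ℕ, (j : ℝ) / n ≤ ((j + 1 : ℕ) : ℝ) / n := fun j => by
      gcongr; simp
    have hint : ∀ j < n, IntervalIntegrable (fun u : ℝ => f (⌊u * n⌋₊ / n)) volume
        ((j : ℝ) / n) (((j + 1 : ℕ) : ℝ) / n) := fun j _ => by
      rw [intervalIntegrable_iff_integrableOn_Ioo_of_le (hle j),
        integrableOn_congr_fun (hcongr j) measurableSet_Ioo]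
      exact integrableOn_const (by simp)
    have := intervalIntegral.sum_integral_adjacent_intervals (a := fun j : ℕ => (j : ℝ) / n) hint
    rw [show ((n : ℕ) : ℝ) / n = 1 from div_self hn'.ne', Nat.cast_zero, zero_div] at this
    rw [← this]
    refine Finset.sum_congr rfl fun j _ => ?_
    rw [intervalIntegral.integral_congr_Ioo_of_le (hle j) (hcongr j),
      intervalIntegral.integral_const]
    push_cast
    rw [smul_eq_mul]
    ring
  have hlim : Tendsto (fun n : ℕ => ∫ u in (0 : ℝ)..1, f (⌊u * n⌋₊ / n)) atTop
      (𝓝 (∫ u in (0 : ℝ)..1, f u)) := by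
    refine intervalIntegral.tendsto_integral_filter_of_dominated_convergence (fun _ => C) ?_ ?_ ?_ ?_
    · refine Eventually.of_forall fun n => ?_
      have : Measurable fun u : ℝ => f (⌊u * n⌋₊ / n) :=
        (measurable_from_nat (f := fun k : ℕ => f (k / n))).comp
          (Nat.measurable_floor.comp (measurable_id.mul_const (n : ℝ)))
      exact this.aestronglyMeasurable
    · filter_upwards [eventually_gt_atTop 0] with n hn
      have hn' : (0 : ℝ) < n := by exact_mod_cast hn
      refine ae_of_all _ fun u hu => ?_
      rw [Set.uIoc_of_le zero_le_one] at hu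
      refine hC _ ⟨by positivity, ?_⟩
      rw [div_le_one hn']
      calc (⌊u * n⌋₊ : ℝ) ≤ u * n := Nat.floor_le (mul_nonneg hu.1.le hn'.le)
        _ ≤ 1 * n := by gcongr; exact hu.2
        _ = n := one_mul _
    · exact intervalIntegrable_const
    · filter_upwards [hf, compl_mem_ae_iff.2 (measure_singleton (1 : ℝ))] with u hu hu1 hu0
      rw [Set.uIoc_of_le zero_le_one] at hu0
      have hcont := hu ⟨hu0.1, lt_of_le_of_ne hu0.2 hu1⟩
      exact hcont.tendsto.comp
        ((tendsto_nat_floor_mul_div_atTop hu0.1.le).comp tendsto_natCast_atTop_atTop)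
  refine hlim.congr' ?_
  filter_upwards [eventually_gt_atTop 0] with n hn using (key n hn).symm

lemma integral_indicator_mul_indicator_eq_min {s t : ℝ} (hs : s ∈ Set.Icc (0 : ℝ) 1)
    (ht : t ∈ Set.Icc (0 : ℝ) 1) :
    ∫ x in (0 : ℝ)..1, (Set.Iic s).indicator 1 x * (Set.Iic t).indicator (1 : ℝ → ℝ) x
      = min s t := by
  have : ∀ x : ℝ, (Set.Iic s).indicator 1 x * (Set.Iic t).indicator (1 : ℝ → ℝ) x =
      (Set.Iic (min s t)).indicator 1 x := fun x => by
    rw [← Set.Iic_inter_Iic, Set.inter_indicator_one, Pi.mul_apply]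
  simp_rw [this]
  rw [intervalIntegral.integral_of_le zero_le_one, integral_indicator_one measurableSet_Iic,
    measureReal_restrict_apply measurableSet_Iic, Set.inter_comm, Set.Ioc_inter_Iic,
    min_eq_right (min_le_of_left_le hs.2), Real.volume_real_Ioc_of_le (le_min hs.1 ht.1), sub_zero]

lemma intervalIntegrable_indicator_mul_indicator (s t : ℝ) :
    IntervalIntegrable
      (fun x => (Set.Iic s).indicator 1 x * (Set.Iic t).indicator (1 : ℝ → ℝ) x) volume 0 1 := by
  have : (fun x : ℝ => (Set.Iic s).indicator 1 x * (Set.Iic t).indicator (1 : ℝ → ℝ) x) =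
      (Set.Iic (min s t)).indicator 1 := by
    ext x
    rw [← Set.Iic_inter_Iic, Set.inter_indicator_one, Pi.mul_apply]
  rw [this, intervalIntegrable_iff]
  exact (integrableOn_const (by simp)).indicator measurableSet_Iic

/-- The characteristic function of a linear combination of values of a Brownian motion on `[0, 1]`,
the variance being the squared `L²` norm of the corresponding step function. -/
lemma IsStdBM.integral_exp_sum {Ω : Type*} [MeasurableSpace Ω] {P : Measure Ω}
    {W : ℝ → Ω → ℝ} (hW : IsStdBM P W) {n : ℕ} (t c : Fin n → ℝ)
    (ht : ∀ i, t i ∈ Set.Icc (0 : ℝ) 1) :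
    ∫ ω, Complex.exp ((∑ i, c i * W (t i) ω : ℝ) * Complex.I) ∂P =
      Complex.exp (-(∫ x in (0 : ℝ)..1, (∑ i, c i * (Set.Iic (t i)).indicator 1 x) ^ 2 : ℝ) / 2) := by
  obtain ⟨hm, -, -, hlaw⟩ := hW
  have hvar : ∑ i, ∑ j, c i * c j * min (t i) (t j) =
      ∫ x in (0 : ℝ)..1, (∑ i, c i * (Set.Iic (t i)).indicator 1 x) ^ 2 := by
    have : ∀ x : ℝ, (∑ i, c i * (Set.Iic (t i)).indicator (1 : ℝ → ℝ) x) ^ 2 = ∑ i, ∑ j, c i * c j *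
        ((Set.Iic (t i)).indicator 1 x * (Set.Iic (t j)).indicator (1 : ℝ → ℝ) x) := fun x => by
      rw [sq, Finset.sum_mul_sum]
      exact Finset.sum_congr rfl fun i _ => Finset.sum_congr rfl fun j _ => by ring
    simp_rw [this]
    rw [intervalIntegral.integral_finsetSum]
    · refine Finset.sum_congr rfl fun i _ => ?_
      rw [intervalIntegral.integral_finsetSum]
      · refine Finset.sum_congr rfl fun j _ => ?_
        rw [intervalIntegral.integral_const_mul,
          integral_indicator_mul_indicator_eq_min (ht i) (ht j)]
      · exact fun j _ => (intervalIntegrable_indicator_mul_indicator _ _).const_mul _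
    · refine fun i _ => ?_
      have := IntervalIntegrable.sum (f := fun j x => c i * c j *
        ((Set.Iic (t i)).indicator 1 x * (Set.Iic (t j)).indicator (1 : ℝ → ℝ) x)) Finset.univ
        fun j _ => (intervalIntegrable_indicator_mul_indicator (t i) (t j)).const_mul (c i * c j)
      simpa only [Finset.sum_fn] using this
  have hnn : 0 ≤ ∑ i, ∑ j, c i * c j * min (t i) (t j) := by
    rw [hvar]
    exact intervalIntegral.integral_nonneg zero_le_one fun x _ => sq_nonneg _
  have hmeas : Measurable fun ω => ∑ i, c i * W (t i) ω :=
    Finset.measurable_sum _ fun i _ => (hm _).const_mul _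
  have hchar := charFun_gaussianReal (μ := 0)
    (v := (∑ i, ∑ j, c i * c j * min (t i) (t j)).toNNReal) 1
  rw [← hlaw n t c fun i => (ht i).1, charFun_apply_real, integral_map hmeas.aemeasurable
    (by fun_prop)] at hchar
  rw [← hvar]
  simp only [Real.coe_toNNReal _ hnn] at hchar
  convert hchar using 2
  · simp
  · simp [neg_div]

/-- The characteristic function of `∫ B g` for a Brownian bridge `B` and a continuous `g`. -/
lemma IsStdBM.integral_exp_integral_bridge {Ω : Type*} [MeasurableSpace Ω] {P : Measure Ω}
    [IsProbabilityMeasure P] {W : ℝ → Ω → ℝ} (hW : IsStdBM P W) {g : ℝ → ℝ} (hg : Continuous g) :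
    (Measurable fun ω => ∫ u in (0 : ℝ)..1, (W u ω - u * W 1 ω) * g u) ∧
    ∫ ω, Complex.exp ((∫ u in (0 : ℝ)..1, (W u ω - u * W 1 ω) * g u : ℝ) * Complex.I) ∂P =
      Complex.exp (-(∫ x in (0 : ℝ)..1,
        ((∫ u in x..1, g u) - ∫ u in (0 : ℝ)..1, u * g u) ^ 2 : ℝ) / 2) := by
  have hWc : ∀ ω, ContinuousOn (fun t => W t ω) (Set.Ici 0) := hW.2.1
  have hWm : ∀ t, Measurable (W t) := hW.1
  set m := ∫ u in (0 : ℝ)..1, u * g u with hm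
  obtain ⟨G, hG⟩ := isCompact_Icc.exists_bound_of_continuousOn (s := Set.Icc (0 : ℝ) 1)
    hg.continuousOn
  have hG0 : 0 ≤ G := (norm_nonneg _).trans (hG 0 (by simp))
  let Z : ℕ → Ω → ℝ := fun n ω => (∑ j ∈ Finset.range n, W (j / n) ω * g (j / n) / n) - m * W 1 ω
  let H : ℕ → ℝ → ℝ := fun n x =>
    (∑ j ∈ Finset.range n, (Set.Iic ((j : ℝ) / n)).indicator 1 x * g (j / n) / n) - m
  have hZm : ∀ n, Measurable (Z n) := fun n =>
    (Finset.measurable_sum _ fun j _ => ((hWm _).mul_const _).div_const _).sub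
      ((hWm 1).const_mul m)
  have hZlim : ∀ ω, Tendsto (fun n => Z n ω) atTop
      (𝓝 (∫ u in (0 : ℝ)..1, (W u ω - u * W 1 ω) * g u)) := by
    intro ω
    have hc : ContinuousOn (fun u => W u ω * g u) (Set.Ici 0) := (hWc ω).mul hg.continuousOn
    have hc' : ContinuousOn (fun u => W u ω * g u) (Set.Icc 0 1) :=
      hc.mono fun x hx => hx.1
    obtain ⟨C, hC⟩ := isCompact_Icc.exists_bound_of_continuousOn hc'
    have h := (tendsto_sum_div_integral (C := C) hC (ae_of_all _ fun u hu =>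
      hc.continuousAt (Ici_mem_nhds hu.1))).sub_const (m * W 1 ω)
    convert h using 2
    have hi : IntervalIntegrable (fun u => W u ω * g u) volume 0 1 :=
      ContinuousOn.intervalIntegrable (by rwa [Set.uIcc_of_le zero_le_one])
    have hi2 : IntervalIntegrable (fun u => u * g u * W 1 ω) volume 0 1 :=
      Continuous.intervalIntegrable (by fun_prop) _ _
    rw [hm, ← intervalIntegral.integral_mul_const, ← intervalIntegral.integral_sub hi hi2]
    congr 1
    ext u
    ring
  have hHlim : ∀ x ∈ Set.Ioc (0 : ℝ) 1, Tendsto (fun n => H n x) atTop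
      (𝓝 ((∫ u in x..1, g u) - m)) := by
    intro x hx
    have h := (tendsto_sum_div_integral (f := fun u => (Set.Iic u).indicator 1 x * g u) (C := G)
      (fun u hu => by
        by_cases h : x ≤ u
        · simpa [h] using hG u hu
        · simpa [h] using hG0) ?_).sub_const m
    · convert h using 2
      congr 1
      have : ∀ u, (Set.Iic u).indicator 1 x * g u = (Set.Ici x).indicator g u := fun u => by
        by_cases h : x ≤ u <;> simp [h]
      simp_rw [this]
      rw [intervalIntegral.integral_of_le hx.2, intervalIntegral.integral_of_le zero_le_one,
        setIntegral_indicator measurableSet_Ici, ← integral_Icc_eq_integral_Ioc]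
      congr 2
      ext u
      simp only [Set.mem_Icc, Set.mem_inter_iff, Set.mem_Ioc, Set.mem_Ici]
      exact ⟨fun h => ⟨⟨hx.1.trans_le h.1, h.2⟩, h.1⟩, fun h => ⟨h.2, h.1.2⟩⟩
    · filter_upwards [compl_mem_ae_iff.2 (measure_singleton x)] with u hu _
      rcases lt_or_gt_of_ne (show u ≠ x from hu) with h | h
      · refine (continuousAt_const (y := (0 : ℝ))).congr ?_
        filter_upwards [Iio_mem_nhds h] with v hv
        simp [not_le.2 (Set.mem_Iio.1 hv)]
      · refine hg.continuousAt.congr ?_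
        filter_upwards [Ioi_mem_nhds h] with v hv
        simp [(Set.mem_Ioi.1 hv).le]
  have hHb : ∀ n x, |H n x| ≤ G + |m| := by
    intro n x
    refine (abs_sub _ _).trans (add_le_add_left ?_ _)
    refine (Finset.abs_sum_le_sum_abs _ _).trans ?_
    have hterm : ∀ j ∈ Finset.range n,
        |(Set.Iic ((j : ℝ) / n)).indicator 1 x * g (j / n) / n| ≤ G / n := by
      intro j hj
      have hjn : (j : ℝ) / n ∈ Set.Icc (0 : ℝ) 1 := ⟨by positivity,
        div_le_one_of_le₀ (by exact_mod_cast (Finset.mem_range.1 hj).le) (by positivity)⟩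
      rw [abs_div, Nat.abs_cast]
      gcongr
      by_cases h : x ≤ (j : ℝ) / n
      · simpa [h] using hG _ hjn
      · simpa [h] using hG0
    refine (Finset.sum_le_sum hterm).trans ?_
    rcases Nat.eq_zero_or_pos n with rfl | hn
    · simpa using hG0
    · have : (n : ℝ) ≠ 0 := by positivity
      simp [mul_div_cancel₀ _ this]
  have hchar : ∀ n : ℕ, 0 < n → ∫ ω, Complex.exp (Z n ω * Complex.I) ∂P =
      Complex.exp (-(∫ x in (0 : ℝ)..1, (H n x) ^ 2 : ℝ) / 2) := by
    intro n hn
    have hn' : (0 : ℝ) < n := by exact_mod_cast hn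
    have h := hW.integral_exp_sum (n := n + 1) (fun i => ((i : ℕ) : ℝ) / n)
      (fun i => if (i : ℕ) < n then g ((i : ℕ) / n) / n else -m) (fun i => ⟨by positivity,
        div_le_one_of_le₀ (by exact_mod_cast Nat.lt_succ_iff.1 i.2) hn'.le⟩)
    have hsum : ∀ F : ℝ → ℝ, ∑ i : Fin (n + 1),
        (if (i : ℕ) < n then g ((i : ℕ) / n) / n else -m) * F ((i : ℕ) / n) =
        (∑ j ∈ Finset.range n, F (j / n) * g (j / n) / n) - m * F 1 := by
      intro F
      rw [Fin.sum_univ_eq_sum_range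
        (fun i => (if i < n then g ((i : ℝ) / n) / n else -m) * F ((i : ℝ) / n)),
        Finset.sum_range_succ, if_neg (lt_irrefl n), div_self hn'.ne', neg_mul, ← sub_eq_add_neg]
      congr 1
      refine Finset.sum_congr rfl fun j hj => ?_
      rw [if_pos (Finset.mem_range.1 hj)]
      ring
    simp_rw [fun ω => hsum fun s => W s ω, fun x => hsum fun s => (Set.Iic s).indicator 1 x] at h
    rw [h]
    congr 4
    refine intervalIntegral.integral_congr_Ioo_of_le zero_le_one fun x hx => ?_
    simp [H, hx.2.le]
  refine ⟨measurable_of_tendsto_metrizable hZm (tendsto_pi_nhds.2 hZlim), ?_⟩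
  have hleft : Tendsto (fun n => ∫ ω, Complex.exp (Z n ω * Complex.I) ∂P) atTop
      (𝓝 (∫ ω, Complex.exp ((∫ u in (0 : ℝ)..1, (W u ω - u * W 1 ω) * g u : ℝ) *
        Complex.I) ∂P)) := by
    refine tendsto_integral_of_dominated_convergence (fun _ => 1) (fun n => ?_)
      (integrable_const _) (fun n => ae_of_all _ fun ω => ?_) (ae_of_all _ fun ω => ?_)
    · have := hZm n
      exact Measurable.aestronglyMeasurable (by fun_prop)
    · rw [Complex.norm_exp_ofReal_mul_I]
    · exact (Complex.continuous_exp.tendsto _).comp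
        (((Complex.continuous_ofReal.tendsto _).comp (hZlim ω)).mul_const _)
  have hright : Tendsto (fun n => ∫ x in (0 : ℝ)..1, (H n x) ^ 2) atTop
      (𝓝 (∫ x in (0 : ℝ)..1, ((∫ u in x..1, g u) - m) ^ 2)) := by
    refine intervalIntegral.tendsto_integral_filter_of_dominated_convergence
      (fun _ => (G + |m|) ^ 2) (Eventually.of_forall fun n => ?_)
      (Eventually.of_forall fun n => ae_of_all _ fun x _ => ?_) intervalIntegrable_const
      (ae_of_all _ fun x hx => ?_)
    · refine Measurable.aestronglyMeasurable (((Finset.measurable_sum _ fun j _ => ?_).sub_const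
        _).pow_const 2)
      exact ((measurable_one.indicator measurableSet_Iic).mul_const _).div_const _
    · rw [norm_pow]
      exact pow_le_pow_left₀ (norm_nonneg _) (hHb n x) 2
    · rw [Set.uIoc_of_le zero_le_one] at hx
      exact (hHlim x hx).pow 2
  refine tendsto_nhds_unique hleft (Tendsto.congr' (f₁ := fun n =>
    Complex.exp (-(∫ x in (0 : ℝ)..1, (H n x) ^ 2 : ℝ) / 2)) ?_ ?_)
  · filter_upwards [eventually_gt_atTop 0] with n hn using (hchar n hn).symm
  · exact (Complex.continuous_exp.tendsto _).comp
      (((Complex.continuous_ofReal.tendsto _).comp hright).neg.div_const _)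

lemma integral_exp_neg_mul_sq_gaussianReal {v : NNReal} (hv : v ≠ 0) {c : ℝ} (hc : 0 ≤ c) :
    ∫ x, Real.exp (-c * x ^ 2) ∂(gaussianReal 0 v) = (√(1 + 2 * c * v))⁻¹ := by
  have hv' : (0 : ℝ) < v := by positivity
  have h1 : (0 : ℝ) < 1 + 2 * c * v := by positivity
  rw [integral_gaussianReal_eq_integral_smul hv]
  have : ∀ x : ℝ, gaussianPDFReal 0 v x • Real.exp (-c * x ^ 2) =
      (√(2 * Real.pi * v))⁻¹ * Real.exp (-((1 + 2 * c * v) / (2 * v)) * x ^ 2) := fun x => by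
    rw [gaussianPDFReal, smul_eq_mul, mul_assoc, ← Real.exp_add]
    congr 2
    field_simp
    ring
  simp_rw [this]
  rw [integral_const_mul, integral_gaussian, ← Real.sqrt_inv, ← Real.sqrt_mul (by positivity),
    ← Real.sqrt_inv]
  congr 1
  field_simp

/-- The Laplace transform of the squared norm of a centered Gaussian family with diagonal
covariance. -/
lemma integral_exp_neg_mul_sum_sq {Ω ι : Type*} [MeasurableSpace Ω] [Fintype ι] {P : Measure Ω}
    [IsProbabilityMeasure P] {X : ι → Ω → ℝ} (hX : ∀ i, Measurable (X i)) {v : ι → NNReal}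
    (hv : ∀ i, v i ≠ 0)
    (hchar : ∀ a : ι → ℝ, ∫ ω, Complex.exp ((∑ i, a i * X i ω : ℝ) * Complex.I) ∂P =
      Complex.exp (-(∑ i, a i ^ 2 * v i : ℝ) / 2)) {c : ℝ} (hc : 0 ≤ c) :
    ∫ ω, Real.exp (-c * ∑ i, X i ω ^ 2) ∂P = ∏ i, (√(1 + 2 * c * v i))⁻¹ := by
  have hXm : Measurable fun ω i => X i ω := measurable_pi_lambda _ hX
  have hlaw : P.map (fun ω i => X i ω) = Measure.pi fun i => gaussianReal 0 (v i) := by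
    have : IsProbabilityMeasure (P.map fun ω i => X i ω) :=
      Measure.isProbabilityMeasure_map hXm.aemeasurable
    rw [← charFun_eq_pi_iff]
    intro t
    rw [charFun_apply, ← MeasurableEquiv.coe_toLp, integral_map_equiv,
      integral_map hXm.aemeasurable (Measurable.aestronglyMeasurable (by fun_prop))]
    simp_rw [charFun_gaussianReal, ← Complex.exp_sum]
    convert hchar t using 3
    · simp [PiLp.inner_apply]
    · push_cast
      rw [← Finset.sum_neg_distrib, Finset.sum_div]
      exact Finset.sum_congr rfl fun i _ => by ring
  have hint := integral_map (μ := P) hXm.aemeasurable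
    (f := fun x : ι → ℝ => ∏ i, Real.exp (-c * x i ^ 2))
    (Measurable.aestronglyMeasurable (by fun_prop))
  rw [hlaw, integral_fintype_prod_eq_prod (fun _ y => Real.exp (-c * y ^ 2))] at hint
  simp_rw [Finset.mul_sum, Real.exp_sum, ← hint]
  exact Finset.prod_congr rfl fun i _ => integral_exp_neg_mul_sq_gaussianReal (hv i) hc

/-- The Laplace transform of `∑ (∫ B φ_i)²` for a Brownian bridge `B`, when the `Φ_i`
representing `∫ B φ_i` as a Wiener integral are orthogonal. -/
lemma IsStdBM.integral_exp_neg_mul_sum_sq {Ω ι : Type*} [MeasurableSpace Ω] [Fintype ι]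
    [DecidableEq ι] {P : Measure Ω} [IsProbabilityMeasure P] {W : ℝ → Ω → ℝ} (hW : IsStdBM P W)
    {φ Φ : ι → ℝ → ℝ} (hφ : ∀ i, Continuous (φ i)) (hΦ : ∀ i, Continuous (Φ i))
    (hφΦ : ∀ i x, (∫ u in x..1, φ i u) - ∫ u in (0 : ℝ)..1, u * φ i u = Φ i x)
    {v : ι → NNReal} (hv : ∀ i, v i ≠ 0)
    (horth : ∀ i j, ∫ x in (0 : ℝ)..1, Φ i x * Φ j x = if i = j then (v i : ℝ) else 0)
    {c : ℝ} (hc : 0 ≤ c) :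
    ∫ ω, Real.exp (-c * ∑ i, (∫ u in (0 : ℝ)..1, (W u ω - u * W 1 ω) * φ i u) ^ 2) ∂P =
      ∏ i, (√(1 + 2 * c * v i))⁻¹ := by
  refine _root_.integral_exp_neg_mul_sum_sq
    (fun i => (hW.integral_exp_integral_bridge (hφ i)).1) hv (fun a => ?_) hc
  have hcont : Continuous fun u => ∑ i, a i * φ i u := by fun_prop
  convert (hW.integral_exp_integral_bridge hcont).2 using 8 with ω
  · have hint : ∀ i, IntervalIntegrable (fun u => (W u ω - u * W 1 ω) * (a i * φ i u))
        volume 0 1 := fun i => by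
      refine ContinuousOn.intervalIntegrable (ContinuousOn.mul (ContinuousOn.sub ?_ ?_) ?_)
      · refine (hW.2.1 ω).mono fun x hx => ?_
        rw [Set.uIcc_of_le zero_le_one] at hx
        exact hx.1
      · fun_prop
      · have := hφ i
        fun_prop
    simp_rw [Finset.mul_sum]
    rw [intervalIntegral.integral_finsetSum fun i _ => hint i]
    refine Finset.sum_congr rfl fun i _ => ?_
    rw [← intervalIntegral.integral_const_mul]
    congr 1
    ext u
    ring
  · have hrep : ∀ x, (∫ u in x..1, ∑ i, a i * φ i u) - ∫ u in (0 : ℝ)..1, u * ∑ i, a i * φ i u =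
        ∑ i, a i * Φ i x := fun x => by
      simp_rw [Finset.mul_sum]
      rw [intervalIntegral.integral_finsetSum, intervalIntegral.integral_finsetSum,
        ← Finset.sum_sub_distrib]
      · refine Finset.sum_congr rfl fun i _ => ?_
        simp_rw [mul_left_comm _ (a i)]
        rw [intervalIntegral.integral_const_mul, intervalIntegral.integral_const_mul, ← mul_sub,
          hφΦ]
      all_goals
        intro i _
        have := hφ i
        exact Continuous.intervalIntegrable (by fun_prop) _ _
    simp_rw [hrep, sq, Finset.sum_mul_sum]
    rw [intervalIntegral.integral_finsetSum]
    · refine Finset.sum_congr rfl fun i _ => ?_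
      rw [intervalIntegral.integral_finsetSum]
      · simp_rw [fun x j => mul_mul_mul_comm (a i) (Φ i x) (a j) (Φ j x),
          intervalIntegral.integral_const_mul, horth]
        simp
      · intro j _
        exact Continuous.intervalIntegrable (by fun_prop) _ _
    · intro i _
      exact Continuous.intervalIntegrable (by fun_prop) _ _

lemma integral_cos_two_pi_mul_intCast (m : ℤ) :
    ∫ x in (0 : ℝ)..1, Real.cos (2 * Real.pi * m * x) = if m = 0 then 1 else 0 := by
  split_ifs with h
  · simp [h]
  · have hm : (2 * Real.pi * m : ℝ) ≠ 0 := by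
      have : (m : ℝ) ≠ 0 := by exact_mod_cast h
      positivity
    rw [intervalIntegral.integral_comp_mul_left _ hm, integral_cos]
    have := Real.sin_int_mul_pi (2 * m)
    push_cast at this
    rw [mul_one, mul_zero, Real.sin_zero, show 2 * Real.pi * m = 2 * m * Real.pi by ring, this]
    simp

lemma integral_sin_two_pi_mul_intCast (m : ℤ) :
    ∫ x in (0 : ℝ)..1, Real.sin (2 * Real.pi * m * x) = 0 := by
  by_cases h : m = 0
  · simp [h]
  · have hm : (2 * Real.pi * m : ℝ) ≠ 0 := by
      have : (m : ℝ) ≠ 0 := by exact_mod_cast h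
      positivity
    rw [intervalIntegral.integral_comp_mul_left _ hm, integral_sin]
    have := Real.cos_int_mul_two_pi m
    rw [mul_one, mul_zero, Real.cos_zero, show 2 * Real.pi * m = m * (2 * Real.pi) by ring, this]
    simp

/-- The positive frequencies `2π(k+1)` of the Fourier basis of `[0, 1]`. -/
noncomputable def posFreq (k : ℕ) : ℝ := 2 * Real.pi * (k + 1)

lemma posFreq_pos (k : ℕ) : 0 < posFreq k := by
  unfold posFreq
  positivity

lemma sin_posFreq (k : ℕ) : Real.sin (posFreq k) = 0 := by
  have := Real.sin_nat_mul_pi (2 * (k + 1))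
  push_cast at this
  rw [posFreq, ← this]
  ring_nf

lemma cos_posFreq (k : ℕ) : Real.cos (posFreq k) = 1 := by
  have := Real.cos_nat_mul_two_pi (k + 1)
  push_cast at this
  rw [posFreq, mul_comm, this]

lemma integral_cos_posFreq_add (k l : ℕ) :
    ∫ x in (0 : ℝ)..1, Real.cos (posFreq k * x + posFreq l * x) = 0 := by
  convert (integral_cos_two_pi_mul_intCast (k + l + 2)).trans (if_neg (by omega)) using 2
  ext x
  unfold posFreq
  push_cast
  ring_nf

lemma integral_cos_posFreq_sub (k l : ℕ) :
    ∫ x in (0 : ℝ)..1, Real.cos (posFreq k * x - posFreq l * x) = if k = l then 1 else 0 := by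
  convert integral_cos_two_pi_mul_intCast (k - l) using 2
  · ext x
    unfold posFreq
    push_cast
    ring_nf
  · rw [sub_eq_zero, Nat.cast_inj]

lemma integral_sin_mul_sin_posFreq (k l : ℕ) :
    ∫ x in (0 : ℝ)..1, Real.sin (posFreq k * x) * Real.sin (posFreq l * x) =
      if k = l then 1 / 2 else 0 := by
  have : ∀ x, Real.sin (posFreq k * x) * Real.sin (posFreq l * x) =
      (Real.cos (posFreq k * x - posFreq l * x) - Real.cos (posFreq k * x + posFreq l * x)) / 2 :=
    fun x => by rw [Real.cos_sub, Real.cos_add]; ring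
  simp_rw [this]
  rw [intervalIntegral.integral_div, intervalIntegral.integral_sub
    (Continuous.intervalIntegrable (by fun_prop) _ _)
    (Continuous.intervalIntegrable (by fun_prop) _ _), integral_cos_posFreq_add,
    integral_cos_posFreq_sub]
  split_ifs <;> simp

lemma integral_cos_mul_cos_posFreq (k l : ℕ) :
    ∫ x in (0 : ℝ)..1, Real.cos (posFreq k * x) * Real.cos (posFreq l * x) =
      if k = l then 1 / 2 else 0 := by
  have : ∀ x, Real.cos (posFreq k * x) * Real.cos (posFreq l * x) =
      (Real.cos (posFreq k * x - posFreq l * x) + Real.cos (posFreq k * x + posFreq l * x)) / 2 :=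
    fun x => by rw [Real.cos_sub, Real.cos_add]; ring
  simp_rw [this]
  rw [intervalIntegral.integral_div, intervalIntegral.integral_add
    (Continuous.intervalIntegrable (by fun_prop) _ _)
    (Continuous.intervalIntegrable (by fun_prop) _ _), integral_cos_posFreq_add,
    integral_cos_posFreq_sub]
  split_ifs <;> simp

lemma integral_sin_mul_cos_posFreq (k l : ℕ) :
    ∫ x in (0 : ℝ)..1, Real.sin (posFreq k * x) * Real.cos (posFreq l * x) = 0 := by
  have : ∀ x, Real.sin (posFreq k * x) * Real.cos (posFreq l * x) =
      (Real.sin (2 * Real.pi * (k + l + 2 : ℤ) * x) + Real.sin (2 * Real.pi * (k - l : ℤ) * x)) / 2 :=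
    fun x => by
      have h1 : 2 * Real.pi * (k + l + 2 : ℤ) * x = posFreq k * x + posFreq l * x := by
        unfold posFreq
        push_cast
        ring
      have h2 : 2 * Real.pi * (k - l : ℤ) * x = posFreq k * x - posFreq l * x := by
        unfold posFreq
        push_cast
        ring
      rw [h1, h2, Real.sin_sub, Real.sin_add]
      ring
  simp_rw [this]
  rw [intervalIntegral.integral_div, intervalIntegral.integral_add
    (Continuous.intervalIntegrable (by fun_prop) _ _)
    (Continuous.intervalIntegrable (by fun_prop) _ _), ← Int.cast_natCast, ← Int.cast_natCast]
  have h1 := integral_sin_two_pi_mul_intCast (k + l + 2)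
  have h2 := integral_sin_two_pi_mul_intCast (k - l)
  push_cast at h1 h2 ⊢
  rw [h1, h2]
  simp

lemma hasDerivAt_sin_const_mul (a u : ℝ) :
    HasDerivAt (fun u => Real.sin (a * u)) (a * Real.cos (a * u)) u := by
  simpa [mul_comm] using ((hasDerivAt_id u).const_mul a).sin

lemma hasDerivAt_cos_const_mul (a u : ℝ) :
    HasDerivAt (fun u => Real.cos (a * u)) (-a * Real.sin (a * u)) u := by
  simpa [mul_comm] using ((hasDerivAt_id u).const_mul a).cos

lemma integral_cos_posFreq_sub_integral_mul (k : ℕ) (x : ℝ) :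
    (∫ u in x..1, Real.cos (posFreq k * u)) - ∫ u in (0 : ℝ)..1, u * Real.cos (posFreq k * u) =
      -Real.sin (posFreq k * x) / posFreq k := by
  have h0 := (posFreq_pos k).ne'
  have h1 := hasDerivAt_sin_const_mul (posFreq k)
  have h2 := hasDerivAt_cos_const_mul (posFreq k)
  rw [intervalIntegral.integral_eq_sub_of_hasDerivAt
      (f := fun u => Real.sin (posFreq k * u) / posFreq k)
      (fun u _ => ?_) (Continuous.intervalIntegrable (by fun_prop) _ _),
    intervalIntegral.integral_eq_sub_of_hasDerivAt (f := fun u =>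
      u * Real.sin (posFreq k * u) / posFreq k + Real.cos (posFreq k * u) / posFreq k ^ 2)
      (fun u _ => ?_) (Continuous.intervalIntegrable (by fun_prop) _ _)]
  · simp [sin_posFreq, cos_posFreq, neg_div]
  · refine ((((hasDerivAt_id u).mul (h1 u)).div_const (posFreq k)).add
      ((h2 u).div_const (posFreq k ^ 2))).congr_deriv ?_
    simp only [id]
    field_simp
    ring
  · exact ((h1 u).div_const (posFreq k)).congr_deriv (by field_simp)

lemma integral_sin_posFreq_sub_integral_mul (k : ℕ) (x : ℝ) :
    (∫ u in x..1, Real.sin (posFreq k * u)) - ∫ u in (0 : ℝ)..1, u * Real.sin (posFreq k * u) =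
      Real.cos (posFreq k * x) / posFreq k := by
  have h0 := (posFreq_pos k).ne'
  have h1 := hasDerivAt_sin_const_mul (posFreq k)
  have h2 := hasDerivAt_cos_const_mul (posFreq k)
  rw [intervalIntegral.integral_eq_sub_of_hasDerivAt
      (f := fun u => -(Real.cos (posFreq k * u) / posFreq k))
      (fun u _ => ?_) (Continuous.intervalIntegrable (by fun_prop) _ _),
    intervalIntegral.integral_eq_sub_of_hasDerivAt (f := fun u =>
      -(u * Real.cos (posFreq k * u) / posFreq k) + Real.sin (posFreq k * u) / posFreq k ^ 2)
      (fun u _ => ?_) (Continuous.intervalIntegrable (by fun_prop) _ _)]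
  · simp [sin_posFreq, cos_posFreq]
  · refine ((((hasDerivAt_id u).mul (h2 u)).div_const (posFreq k)).neg.add
      ((h1 u).div_const (posFreq k ^ 2))).congr_deriv ?_
    simp only [id]
    field_simp
    ring
  · exact ((h2 u).div_const (posFreq k)).neg.congr_deriv (by field_simp)

lemma norm_fourierCoeffOn_ofReal_sq {f : ℝ → ℝ} (hf : ContinuousOn f (Set.Icc 0 1)) (n : ℤ) :
    ‖fourierCoeffOn zero_lt_one (fun u => (f u : ℂ)) n‖ ^ 2 =
      (∫ u in (0 : ℝ)..1, f u * Real.cos (2 * Real.pi * n * u)) ^ 2 +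
      (∫ u in (0 : ℝ)..1, f u * Real.sin (2 * Real.pi * n * u)) ^ 2 := by
  rw [← Set.uIcc_of_le zero_le_one] at hf
  have hcoeff : fourierCoeffOn zero_lt_one (fun u => (f u : ℂ)) n =
      (∫ u in (0 : ℝ)..1, f u * Real.cos (2 * Real.pi * n * u) : ℝ) -
      (∫ u in (0 : ℝ)..1, f u * Real.sin (2 * Real.pi * n * u) : ℝ) * Complex.I := by
    have hc : ContinuousOn (fun u => ((f u * Real.cos (2 * Real.pi * n * u) : ℝ) : ℂ))
        (Set.uIcc 0 1) := by fun_prop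
    have hs : ContinuousOn (fun u => ((f u * Real.sin (2 * Real.pi * n * u) : ℝ) : ℂ) * Complex.I)
        (Set.uIcc 0 1) := by fun_prop
    rw [fourierCoeffOn_eq_integral, ← intervalIntegral.integral_ofReal,
      ← intervalIntegral.integral_ofReal, ← intervalIntegral.integral_mul_const,
      ← intervalIntegral.integral_sub hc.intervalIntegrable hs.intervalIntegrable, sub_zero,
      div_one, one_smul]
    congr 1
    ext u
    rw [fourier_coe_apply, smul_eq_mul, show 2 * Real.pi * Complex.I * ((-n : ℤ) : ℂ) * u / (1 : ℝ) =
      ((-(2 * Real.pi * n * u) : ℝ) : ℂ) * Complex.I by push_cast; ring, Complex.exp_mul_I,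
      ← Complex.ofReal_cos, ← Complex.ofReal_sin, Real.cos_neg, Real.sin_neg]
    push_cast
    ring
  rw [hcoeff, ← Complex.normSq_eq_norm_sq, Complex.normSq_apply]
  simp [sq]

/-- **Parseval's identity** in real form for the centered part of a continuous function. -/
lemma hasSum_sq_integral_cos_sin {f : ℝ → ℝ} (hf : ContinuousOn f (Set.Icc 0 1)) :
    HasSum (fun k : ℕ => 2 * ((∫ u in (0 : ℝ)..1, f u * Real.cos (posFreq k * u)) ^ 2 +
        (∫ u in (0 : ℝ)..1, f u * Real.sin (posFreq k * u)) ^ 2))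
      (∫ u in (0 : ℝ)..1, (f u - ∫ v in (0 : ℝ)..1, f v) ^ 2) := by
  have hfI : ContinuousOn f (Set.uIcc 0 1) := by rwa [Set.uIcc_of_le zero_le_one]
  have hfC : ContinuousOn (fun u => (f u : ℂ)) (Set.Icc 0 1) := by fun_prop
  have hL2 : MemLp (fun u => (f u : ℂ)) 2 (volume.restrict (Set.Ioc 0 1)) := by
    obtain ⟨C, hC⟩ := isCompact_Icc.exists_bound_of_continuousOn hfC
    refine MemLp.of_bound ((hfC.mono Set.Ioc_subset_Icc_self).aestronglyMeasurable
      measurableSet_Ioc) C ?_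
    filter_upwards [ae_restrict_mem measurableSet_Ioc] with u hu
      using hC u (Set.Ioc_subset_Icc_self hu)
  have h := (hasSum_sq_fourierCoeffOn zero_lt_one hL2).nat_add_neg
  simp_rw [norm_fourierCoeffOn_ofReal_sq hf] at h
  rw [← hasSum_nat_add_iff' 1] at h
  convert! h using 1
  · ext k
    have hpos : ∀ u, 2 * Real.pi * (((k + 1 : ℕ) : ℤ) : ℝ) * u = posFreq k * u := fun u => by
      simp [posFreq]
    have hneg : ∀ u, 2 * Real.pi * ((-((k + 1 : ℕ) : ℤ) : ℤ) : ℝ) * u = -(posFreq k * u) :=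
      fun u => by
        rw [← hpos]
        push_cast
        ring
    simp_rw [hpos, hneg, Real.cos_neg, Real.sin_neg, mul_neg, intervalIntegral.integral_neg]
    ring
  · set m := ∫ v in (0 : ℝ)..1, f v with hm
    have hsq : IntervalIntegrable (fun u => f u ^ 2) volume 0 1 :=
      (hfI.pow 2).intervalIntegrable
    have hlin : IntervalIntegrable (fun u => 2 * m * f u) volume 0 1 :=
      hfI.intervalIntegrable.const_mul _
    have hexp : ∀ u, (f u - m) ^ 2 = f u ^ 2 - 2 * m * f u + m ^ 2 := fun u => by ring
    simp_rw [hexp]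
    rw [intervalIntegral.integral_add (hsq.sub hlin) intervalIntegrable_const,
      intervalIntegral.integral_sub hsq hlin, intervalIntegral.integral_const_mul]
    simp [← hm]
    ring

lemma tendsto_prod_inv_posFreq {θ : ℝ} (hθ : 0 < θ) :
    Tendsto (fun n : ℕ => ∏ k ∈ Finset.range n, (1 + θ ^ 2 / posFreq k ^ 2)⁻¹) atTop
      (𝓝 (θ / (2 * Real.sinh (θ / 2)))) := by
  have hpi : (Real.pi : ℂ) ≠ 0 := by exact_mod_cast Real.pi_ne_zero
  have h := (Complex.continuous_im.tendsto _).comp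
    (Complex.tendsto_euler_sin_prod ((θ / (2 * Real.pi) : ℝ) * Complex.I))
  have harg : (Real.pi : ℂ) * ((θ / (2 * Real.pi) : ℝ) * Complex.I) =
      ((θ / 2 : ℝ) : ℂ) * Complex.I := by
    push_cast
    field_simp
  have hprod : ∀ k : ℕ, (1 : ℂ) - ((θ / (2 * Real.pi) : ℝ) * Complex.I) ^ 2 / ((k : ℂ) + 1) ^ 2 =
      ((1 + θ ^ 2 / posFreq k ^ 2 : ℝ) : ℂ) := fun k => by
    have hk : (k : ℂ) + 1 ≠ 0 := Nat.cast_add_one_ne_zero k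
    rw [mul_pow, Complex.I_sq, posFreq]
    push_cast
    field_simp
    ring
  simp_rw [harg, hprod, ← Complex.ofReal_prod, Complex.sin_mul_I] at h
  have h' : Tendsto (fun n : ℕ => θ / 2 * ∏ k ∈ Finset.range n, (1 + θ ^ 2 / posFreq k ^ 2)) atTop
      (𝓝 (Real.sinh (θ / 2))) := by
    convert h using 1
    · ext n
      rw [Function.comp_apply, mul_right_comm, ← Complex.ofReal_mul, Complex.im_ofReal_mul]
      simp
    · rw [← Complex.ofReal_sinh, Complex.im_ofReal_mul]
      simp
  have hs : 0 < Real.sinh (θ / 2) := Real.sinh_pos_iff.2 (half_pos hθ)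
  convert (h'.inv₀ hs.ne').const_mul (θ / 2) using 1
  · ext n
    rw [Finset.prod_inv_distrib, mul_inv, mul_inv_cancel_left₀ (half_pos hθ).ne']
  · congr 1
    field_simp

lemma IsStdBM.integral_exp_neg_sum_fourier {Ω : Type*} [MeasurableSpace Ω] {P : Measure Ω}
    [IsProbabilityMeasure P] {W : ℝ → Ω → ℝ} (hW : IsStdBM P W) (θ : ℝ) (N : ℕ) :
    ∫ ω, Real.exp (-(θ ^ 2 / 2) * ∑ k ∈ Finset.range N,
        2 * ((∫ u in (0 : ℝ)..1, (W u ω - u * W 1 ω) * Real.cos (posFreq k * u)) ^ 2 +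
          (∫ u in (0 : ℝ)..1, (W u ω - u * W 1 ω) * Real.sin (posFreq k * u)) ^ 2)) ∂P =
      ∏ k ∈ Finset.range N, (1 + θ ^ 2 / posFreq k ^ 2)⁻¹ := by
  let φ : Fin N ⊕ Fin N → ℝ → ℝ := Sum.elim (fun k u => Real.cos (posFreq k * u))
    (fun k u => Real.sin (posFreq k * u))
  let Φ : Fin N ⊕ Fin N → ℝ → ℝ := Sum.elim (fun k u => -Real.sin (posFreq k * u) / posFreq k)
    (fun k u => Real.cos (posFreq k * u) / posFreq k)
  let v : Fin N ⊕ Fin N → NNReal := Sum.elim (fun k => (1 / (2 * posFreq k ^ 2)).toNNReal)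
    (fun k => (1 / (2 * posFreq k ^ 2)).toNNReal)
  have hpos : ∀ k : ℕ, 0 < 1 / (2 * posFreq k ^ 2) := fun k => by
    have := posFreq_pos k
    positivity
  have h := hW.integral_exp_neg_mul_sum_sq (φ := φ) (Φ := Φ) (v := v) (c := θ ^ 2)
    (by rintro (k | k) <;> simp only [φ, Sum.elim_inl, Sum.elim_inr] <;> fun_prop)
    (by rintro (k | k) <;> simp only [Φ, Sum.elim_inl, Sum.elim_inr] <;> fun_prop)
    (by
      rintro (k | k) x
      · exact integral_cos_posFreq_sub_integral_mul k x
      · exact integral_sin_posFreq_sub_integral_mul k x)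
    (by rintro (k | k) <;> exact (Real.toNNReal_pos.2 (hpos k)).ne')
    (by
      rintro (k | k) (l | l)
      · simp only [Φ, v, Sum.elim_inl, neg_div, neg_mul_neg, div_mul_div_comm,
          intervalIntegral.integral_div, integral_sin_mul_sin_posFreq, Sum.inl.injEq, Fin.val_inj,
          Real.coe_toNNReal _ (hpos k).le]
        split_ifs with hkl
        · subst hkl
          ring
        · simp
      · simp only [Φ, Sum.elim_inl, Sum.elim_inr, div_mul_div_comm, neg_mul,
          intervalIntegral.integral_div, intervalIntegral.integral_neg,
          integral_sin_mul_cos_posFreq]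
        simp
      · simp only [Φ, Sum.elim_inl, Sum.elim_inr, mul_comm (Real.cos _ / _), div_mul_div_comm,
          neg_mul, intervalIntegral.integral_div, intervalIntegral.integral_neg,
          integral_sin_mul_cos_posFreq]
        simp
      · simp only [Φ, v, Sum.elim_inr, div_mul_div_comm,
          intervalIntegral.integral_div, integral_cos_mul_cos_posFreq, Sum.inr.injEq, Fin.val_inj,
          Real.coe_toNNReal _ (hpos k).le]
        split_ifs with hkl
        · subst hkl
          ring
        · simp)
    (sq_nonneg θ)
  simp only [Fintype.sum_sum_type, Fintype.prod_sum_type, φ, v, Sum.elim_inl, Sum.elim_inr,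
    Real.coe_toNNReal _ (hpos _).le] at h
  rw [← Finset.prod_mul_distrib, Fin.prod_univ_eq_prod_range (fun k =>
    (√(1 + 2 * θ ^ 2 * (1 / (2 * posFreq k ^ 2))))⁻¹ *
      (√(1 + 2 * θ ^ 2 * (1 / (2 * posFreq k ^ 2))))⁻¹)] at h
  convert h using 1
  · congr 1
    ext ω
    rw [← Finset.sum_add_distrib, Fin.sum_univ_eq_sum_range (fun k =>
      (∫ u in (0 : ℝ)..1, (W u ω - u * W 1 ω) * Real.cos (posFreq k * u)) ^ 2 +
          (∫ u in (0 : ℝ)..1, (W u ω - u * W 1 ω) * Real.sin (posFreq k * u)) ^ 2),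
      ← Finset.mul_sum, ← mul_assoc, neg_mul, div_mul_cancel₀ _ two_ne_zero]
  · refine Finset.prod_congr rfl fun k _ => ?_
    have := posFreq_pos k
    rw [← mul_inv, Real.mul_self_sqrt (by positivity)]
    congr 2
    field_simp

theorem stmt_6 {Ω : Type*} [MeasurableSpace Ω] (P : Measure Ω) [IsProbabilityMeasure P]
    (W : ℝ → Ω → ℝ) (hW : IsStdBM P W)
    (B : ℝ → Ω → ℝ) (hB : ∀ t ω, B t ω = W t ω - t * W 1 ω)
    (θ : ℝ) (hθ : 0 < θ) :
    ∫ ω, Real.exp (-(θ ^ 2 / 2) *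
        ∫ u in (0:ℝ)..1, (B u ω - ∫ v in (0:ℝ)..1, B v ω) ^ 2) ∂P
      = θ / (2 * Real.sinh (θ / 2)) := by
  have hcont : ∀ ω, ContinuousOn (fun u => W u ω - u * W 1 ω) (Set.Icc 0 1) := fun ω =>
    ((hW.2.1 ω).mono fun x hx => hx.1).sub (by fun_prop)
  have hcos : ∀ k, Measurable fun ω =>
      ∫ u in (0 : ℝ)..1, (W u ω - u * W 1 ω) * Real.cos (posFreq k * u) := fun k =>
    (hW.integral_exp_integral_bridge (by fun_prop)).1
  have hsin : ∀ k, Measurable fun ω =>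
      ∫ u in (0 : ℝ)..1, (W u ω - u * W 1 ω) * Real.sin (posFreq k * u) := fun k =>
    (hW.integral_exp_integral_bridge (by fun_prop)).1
  simp_rw [hB]
  refine tendsto_nhds_unique ?_ (tendsto_prod_inv_posFreq hθ)
  simp_rw [← hW.integral_exp_neg_sum_fourier θ]
  refine tendsto_integral_of_dominated_convergence (fun _ => 1) (fun N => ?_)
    (integrable_const _) (fun N => ae_of_all _ fun ω => ?_) (ae_of_all _ fun ω => ?_)
  · exact Measurable.aestronglyMeasurable (by fun_prop)
  · rw [Real.norm_eq_abs, Real.abs_exp, Real.exp_le_one_iff, neg_mul, neg_nonpos]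
    exact mul_nonneg (by positivity) (Finset.sum_nonneg fun k _ => by positivity)
  · exact (Real.continuous_exp.tendsto _).comp
      ((hasSum_sq_integral_cos_sin (hcont ω)).tendsto_sum_nat.const_mul _)
end

section
/- Let W be a standard Brownian motion and let B(t) = W(t) − t W(1) for t ∈ [0,1] be the standard Brownian bridge. For θ > 0 and z ∈ ℝ, E[ exp( −∫_0^1 ( (θ²/2) B(u)² + z B(u) ) du ) ] = ( θ / sinh θ )^{1/2} · exp( −( z² / (2 θ²) ) ( 2 (cosh θ − 1) / ( θ sinh θ ) − 1 ) ). -/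
open MeasureTheory ProbabilityTheory Filter

open scoped NNReal ENNReal

namespace IsStdBM

variable {Ω : Type*} [MeasurableSpace Ω] {P : Measure Ω} {W : ℝ → Ω → ℝ}

lemma map_sum_eq_gaussianReal (hW : IsStdBM P W) {ι : Type*} [Fintype ι] (t c : ι → ℝ)
    (ht : ∀ i, 0 ≤ t i) :
    P.map (fun ω ↦ ∑ i, c i * W (t i) ω) =
      gaussianReal 0 (∑ i, ∑ j, c i * c j * min (t i) (t j)).toNNReal := by
  have h := hW.2.2.2 (Fintype.card ι) (t ∘ (Fintype.equivFin ι).symm)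
    (c ∘ (Fintype.equivFin ι).symm) fun i ↦ ht _
  have hsum (ω : Ω) : ∑ i, c i * W (t i) ω = ∑ i, (c ∘ (Fintype.equivFin ι).symm) i *
      W ((t ∘ (Fintype.equivFin ι).symm) i) ω :=
    ((Fintype.equivFin ι).symm.sum_comp fun i ↦ c i * W (t i) ω).symm
  simp_rw [hsum]
  rw [h, ← (Fintype.equivFin ι).symm.sum_comp]
  congr 2
  exact Finset.sum_congr rfl fun i _ ↦
    (Fintype.equivFin ι).symm.sum_comp fun j ↦ c _ * c j * min (t _) (t j)

lemma isGaussianProcess (hW : IsStdBM P W) : IsGaussianProcess (fun t : ℝ≥0 ↦ W t) P where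
  hasGaussianLaw I := by
    refine ⟨isGaussian_of_map_eq_gaussianReal fun L ↦ ⟨0, (∑ i : I, ∑ j : I,
      L (Pi.single i 1) * L (Pi.single j 1) * min ((i : ℝ≥0) : ℝ) (j : ℝ≥0)).toNNReal, ?_⟩⟩
    rw [Measure.map_map L.continuous.measurable
      (measurable_pi_lambda (fun ω ↦ I.restrict fun t : ℝ≥0 ↦ W t ω) fun i ↦ hW.1 _)]
    convert hW.map_sum_eq_gaussianReal (fun i : I ↦ ((i : ℝ≥0) : ℝ))
      (fun i ↦ L (Pi.single i 1)) fun i ↦ NNReal.coe_nonneg _ using 2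
    ext ω
    simp only [Function.comp_apply]
    conv_lhs => rw [← Finset.univ_sum_single (I.restrict fun t : ℝ≥0 ↦ W t ω)]
    rw [map_sum]
    refine Finset.sum_congr rfl fun i _ ↦ ?_
    have : (Pi.single i (I.restrict (fun t : ℝ≥0 ↦ W t ω) i) : I → ℝ)
        = W i ω • Pi.single i 1 := by
      ext j
      by_cases hij : j = i
      · subst hij; simp
      · simp [hij]
    rw [this, map_smul, smul_eq_mul, mul_comm]

lemma memLp_two (hW : IsStdBM P W) {t : ℝ} (ht : 0 ≤ t) : MemLp (W t) 2 P :=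
  (hW.isGaussianProcess.hasGaussianLaw_eval ⟨t, ht⟩).memLp_two

lemma variance_sum (hW : IsStdBM P W) {ι : Type*} [Fintype ι] (t c : ι → ℝ)
    (ht : ∀ i, 0 ≤ t i) (hv : 0 ≤ ∑ i, ∑ j, c i * c j * min (t i) (t j)) :
    Var[fun ω ↦ ∑ i, c i * W (t i) ω; P] = ∑ i, ∑ j, c i * c j * min (t i) (t j) := by
  have hm : Measurable fun ω ↦ ∑ i, c i * W (t i) ω :=
    Finset.measurable_sum _ fun i _ ↦ (hW.1 _).const_mul _
  rw [← variance_id_map hm.aemeasurable, hW.map_sum_eq_gaussianReal t c ht,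
    variance_id_gaussianReal, Real.coe_toNNReal _ hv]

lemma covariance_eq [IsProbabilityMeasure P] (hW : IsStdBM P W) {s t : ℝ}
    (hs : 0 ≤ s) (ht : 0 ≤ t) :
    cov[W s, W t; P] = min s t := by
  have h1 := hW.variance_sum ![s] ![1] (by simpa) (by simpa)
  have h2 := hW.variance_sum ![t] ![1] (by simpa) (by simpa)
  have h3 := hW.variance_sum ![s, t] ![1, 1] (by simp [Fin.forall_fin_two, hs, ht])
    (by simp [min_comm t s]; positivity)
  simp [min_comm t s] at h1 h2 h3
  have h4 := variance_fun_add (hW.memLp_two hs) (hW.memLp_two ht)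
  linarith

end IsStdBM

/-- The bridge associated with a path indexed by time. -/
def bridge {Ω : Type*} (W : ℝ → Ω → ℝ) (t : ℝ) (ω : Ω) : ℝ := W t ω - t * W 1 ω

namespace IsStdBM

variable {Ω : Type*} [MeasurableSpace Ω] {P : Measure Ω} {W : ℝ → Ω → ℝ}

lemma measurable_bridge (hW : IsStdBM P W) (t : ℝ) : Measurable (bridge W t) :=
  (hW.1 t).sub ((hW.1 1).const_mul t)

lemma isGaussianProcess_bridge (hW : IsStdBM P W) :
    IsGaussianProcess (fun t : ℝ≥0 ↦ bridge W t) P := by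
  classical
  exact hW.isGaussianProcess.of_isGaussianProcess fun t ↦ ⟨{t, 1},
    .proj ⟨t, by simp⟩ - (t : ℝ) • .proj ⟨1, by simp⟩, fun ω ↦ by simp [bridge]⟩

lemma memLp_two_bridge (hW : IsStdBM P W) {t : ℝ} (ht : 0 ≤ t) : MemLp (bridge W t) 2 P :=
  (hW.isGaussianProcess_bridge.hasGaussianLaw_eval ⟨t, ht⟩).memLp_two

lemma covariance_bridge [IsProbabilityMeasure P] (hW : IsStdBM P W) {s t : ℝ}
    (hs : 0 ≤ s) (hst : s ≤ t) (ht : t ≤ 1) :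
    cov[bridge W t, bridge W s; P] = s * (1 - t) := by
  have ht0 := hs.trans hst
  have h1 := hW.memLp_two zero_le_one
  have := covariance_fun_sub_fun_sub (hW.memLp_two ht0) (h1.const_mul t) (hW.memLp_two hs)
    (h1.const_mul s)
  unfold bridge
  rw [this, covariance_const_mul_left, covariance_const_mul_left, covariance_const_mul_right,
    covariance_const_mul_right, hW.covariance_eq ht0 hs, hW.covariance_eq ht0 zero_le_one,
    hW.covariance_eq zero_le_one hs, hW.covariance_eq zero_le_one zero_le_one,
    min_eq_right hst, min_eq_left ht, min_eq_right (hst.trans ht), min_self]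
  ring

/-- The increment of the bridge from `s` to `t`, corrected by the conditional mean, is centered
Gaussian. -/
lemma map_bridge_innovation (hW : IsStdBM P W) {s t : ℝ} (hs : 0 ≤ s) (hst : s ≤ t) (ht : t ≤ 1)
    (hs1 : s < 1) :
    P.map (fun ω ↦ bridge W t ω - (1 - t) / (1 - s) * bridge W s ω) =
      gaussianReal 0 ((t - s) * (1 - t) / (1 - s)).toNNReal := by
  have h := hW.map_sum_eq_gaussianReal ![t, s, 1]
    ![1, -((1 - t) / (1 - s)), -(t - (1 - t) / (1 - s) * s)]
    (by simp [Fin.forall_fin_succ, hs, hs.trans hst])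
  have h0 : (1 - s : ℝ) ≠ 0 := by linarith
  have hsum (ω : Ω) : bridge W t ω - (1 - t) / (1 - s) * bridge W s ω =
      ∑ i, (![1, -((1 - t) / (1 - s)), -(t - (1 - t) / (1 - s) * s)] : Fin 3 → ℝ) i *
        W ((![t, s, 1] : Fin 3 → ℝ) i) ω := by
    simp [Fin.sum_univ_three, bridge]
    ring
  simp_rw [hsum]
  rw [h]
  congr 2
  simp [Fin.sum_univ_three, min_eq_right hst, min_eq_left hst, min_eq_left ht,
    min_eq_right ht, min_eq_right hs1.le, min_eq_left hs1.le]
  field_simp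
  ring

lemma indepFun_bridge_innovation [IsProbabilityMeasure P] (hW : IsStdBM P W)
    {ι : Type*} (r : ι → ℝ) {s t : ℝ}
    (hr : ∀ i, 0 ≤ r i) (hrs : ∀ i, r i ≤ s) (hs : 0 ≤ s) (hst : s ≤ t) (ht : t ≤ 1)
    (hs1 : s < 1) :
    IndepFun (fun ω i ↦ bridge W (r i) ω)
      (fun ω ↦ bridge W t ω - (1 - t) / (1 - s) * bridge W s ω) P := by
  classical
  lift r to ι → ℝ≥0 using hr
  have ht0 := hs.trans hst
  lift s to ℝ≥0 using hs
  lift t to ℝ≥0 using ht0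
  have hm : ∀ t, AEMeasurable (bridge W t) P := fun t ↦ (hW.measurable_bridge t).aemeasurable
  have key : IndepFun (fun ω i ↦ bridge W (r i) ω)
      (fun ω (_ : Unit) ↦ bridge W t ω - (1 - t) / (1 - s) * bridge W s ω) P := by
    refine IsGaussianProcess.indepFun_of_covariance_eq_zero (X := fun i ↦ bridge W (r i))
      (Y := fun (_ : Unit) ω ↦ bridge W t ω - (1 - t) / (1 - s) * bridge W s ω) ?_
      (fun i ↦ hm _) (fun _ ↦ (hm t).sub ((hm s).const_mul _)) fun i _ ↦ ?_
    · refine hW.isGaussianProcess_bridge.of_isGaussianProcess fun x ↦ ?_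
      rcases x with i | _
      · exact ⟨{r i}, .proj ⟨r i, by simp⟩, fun ω ↦ rfl⟩
      · exact ⟨{t, s}, .proj ⟨t, by simp⟩ -
          ((1 - t) / (1 - s) : ℝ) • .proj ⟨s, by simp⟩, fun ω ↦ by simp⟩
    · rw [covariance_comm, covariance_fun_sub_left (hW.memLp_two_bridge t.coe_nonneg)
        ((hW.memLp_two_bridge s.coe_nonneg).const_mul _) (hW.memLp_two_bridge (r i).coe_nonneg),
        covariance_const_mul_left, hW.covariance_bridge (r i).coe_nonneg ((hrs i).trans hst) ht,
        hW.covariance_bridge (r i).coe_nonneg (hrs i) hs1.le]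
      have h0 : (1 - s : ℝ) ≠ 0 := by linarith
      field_simp
      ring
  exact key.comp measurable_id (measurable_pi_apply ())

end IsStdBM

lemma lintegral_exp_quadratic_gaussianReal {v a : ℝ} (hv : 0 < v) (ha : 0 < 1 + 2 * a * v) (b c : ℝ) :
    ∫⁻ x, ENNReal.ofReal (Real.exp (-(a * x ^ 2 + b * x + c))) ∂gaussianReal 0 v.toNNReal =
      ENNReal.ofReal (Real.exp (b ^ 2 * v / (2 * (1 + 2 * a * v)) - c) / √(1 + 2 * a * v)) := by
  obtain ⟨D, hD⟩ : ∃ D, D = 1 + 2 * a * v := ⟨_, rfl⟩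
  rw [← hD] at ha ⊢
  have hv0 : v.toNNReal ≠ 0 := by simpa using hv
  have hv' : 0 < v / D := div_pos hv ha
  have hv1 : (v / D).toNNReal ≠ 0 := by simpa using hv'
  set K := Real.exp (b ^ 2 * v / (2 * D) - c) / √D with hK
  have key (x : ℝ) : gaussianPDFReal 0 v.toNNReal x * Real.exp (-(a * x ^ 2 + b * x + c)) =
      K * gaussianPDFReal (-(b * v / D)) (v / D).toNNReal x := by
    rw [gaussianPDFReal, gaussianPDFReal, Real.coe_toNNReal _ hv.le, Real.coe_toNNReal _ hv'.le,
      hK, ← mul_div_assoc, Real.sqrt_div (by positivity)]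
    have h1 : √D ≠ 0 := (Real.sqrt_pos.2 ha).ne'
    have h2 : √(2 * Real.pi * v) ≠ 0 := (Real.sqrt_pos.2 (by positivity)).ne'
    have h3 : -(x - 0) ^ 2 / (2 * v) + -(a * x ^ 2 + b * x + c) =
        (b ^ 2 * v / (2 * D) - c) +
        -(x - -(b * v / D)) ^ 2 / (2 * (v / D)) := by
      have ha' : a = (D - 1) / (2 * v) := by
        rw [hD]
        field_simp
        ring
      rw [ha']
      field_simp
      ring
    rw [mul_assoc, ← Real.exp_add, h3, Real.exp_add]
    field_simp
  rw [gaussianReal_of_var_ne_zero _ hv0,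
    lintegral_withDensity_eq_lintegral_mul _ (measurable_gaussianPDF _ _) (by fun_prop)]
  simp only [Pi.mul_apply, gaussianPDF,
    ← ENNReal.ofReal_mul (gaussianPDFReal_nonneg 0 v.toNNReal _), key]
  have hK0 : 0 ≤ K := by positivity
  simp only [ENNReal.ofReal_mul hK0]
  rw [lintegral_const_mul _ (by fun_prop), lintegral_gaussianPDFReal_eq_one _ hv1, mul_one]

/-- The quotient of the Mehler kernel by the heat kernel, `r` steps of length `h` away from the
terminal point `m`, where each step contributes the hyperbolic angle `φ`. -/
noncomputable def mehlerRatio (φ h m : ℝ) (r : ℕ) (y : ℝ) : ℝ :=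
  √(r * Real.sinh φ / Real.sinh (r * φ)) *
    Real.exp (-(1 / (2 * h)) * (Real.sinh φ * ((y ^ 2 + m ^ 2) * Real.cosh (r * φ) - 2 * y * m) /
      Real.sinh (r * φ) - (y - m) ^ 2 / r))

lemma mehlerRatio_nonneg (φ h m : ℝ) (r : ℕ) (y : ℝ) : 0 ≤ mehlerRatio φ h m r y := by
  unfold mehlerRatio
  positivity

@[fun_prop]
lemma measurable_mehlerRatio (φ h m : ℝ) (r : ℕ) : Measurable (mehlerRatio φ h m r) := by
  unfold mehlerRatio
  fun_prop

lemma mehlerRatio_one {φ h : ℝ} (hφ : 0 < φ) (hh : 0 < h) (m y : ℝ) :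
    mehlerRatio φ h m 1 y = Real.exp (-((Real.cosh φ - 1) / (2 * h)) * (y ^ 2 + m ^ 2)) := by
  have hs : Real.sinh φ ≠ 0 := (Real.sinh_pos_iff.2 hφ).ne'
  simp only [mehlerRatio, Nat.cast_one, one_mul, div_self hs, Real.sqrt_one, div_one]
  congr 1
  field_simp
  ring

/-- Recursion satisfied by `mehlerRatio` under the transition of a bridge ending at `m`. -/
lemma lintegral_mehlerRatio {φ h : ℝ} (hφ : 0 < φ) (hh : 0 < h) (m y : ℝ) {r : ℕ} (hr : 0 < r) :
    ∫⁻ x, ENNReal.ofReal (Real.exp (-((Real.cosh φ - 1) / (2 * h)) *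
        (y ^ 2 + (m + r / (r + 1) * (y - m) + x) ^ 2)) *
        mehlerRatio φ h m r (m + r / (r + 1) * (y - m) + x))
      ∂gaussianReal 0 (h * r / (r + 1)).toNNReal = ENNReal.ofReal (mehlerRatio φ h m (r + 1) y) := by
  have hr' : (0 : ℝ) < r := Nat.cast_pos.2 hr
  have hs0 : 0 < Real.sinh φ := Real.sinh_pos_iff.2 hφ
  have hS : 0 < Real.sinh (r * φ) := Real.sinh_pos_iff.2 (by positivity)
  have hC : 0 < Real.cosh (r * φ) := Real.cosh_pos _
  have hc0 : 0 < Real.cosh φ := Real.cosh_pos _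
  have hc := Real.cosh_sq φ
  have hCS := Real.cosh_sq (r * φ)
  have hS' : Real.sinh ((r + 1) * φ) =
      Real.sinh (r * φ) * Real.cosh φ + Real.cosh (r * φ) * Real.sinh φ := by
    rw [add_mul, one_mul, Real.sinh_add]
  have hC' : Real.cosh ((r + 1) * φ) =
      Real.cosh (r * φ) * Real.cosh φ + Real.sinh (r * φ) * Real.sinh φ := by
    rw [add_mul, one_mul, Real.cosh_add]
  simp only [mehlerRatio, Nat.cast_add, Nat.cast_one, hS', hC']
  generalize Real.sinh φ = s at *
  generalize Real.cosh φ = c at *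
  generalize Real.sinh (r * φ) = S at *
  generalize Real.cosh (r * φ) = C at *
  generalize (r : ℝ) = ρ at *
  set q := m + ρ / (ρ + 1) * (y - m) with hq
  set a := 1 / (2 * h) * (c - 1 + s * C / S - 1 / ρ) with ha
  set b := (1 / h) * (q * (S * c + C * s) / S - y - s * m / S) with hb
  set d := 1 / (2 * h) * ((c - 1) * (y ^ 2 + q ^ 2) + s * ((q ^ 2 + m ^ 2) * C - 2 * q * m) / S -
    (q - m) ^ 2 / ρ) with hd
  have hexp (x : ℝ) : Real.exp (-((c - 1) / (2 * h)) * (y ^ 2 + (q + x) ^ 2)) *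
      (√(ρ * s / S) * Real.exp (-(1 / (2 * h)) * (s * (((q + x) ^ 2 + m ^ 2) * C -
        2 * (q + x) * m) / S - (q + x - m) ^ 2 / ρ))) =
      √(ρ * s / S) * Real.exp (-(a * x ^ 2 + b * x + d)) := by
    rw [mul_left_comm, ← Real.exp_add]
    congr 2
    rw [ha, hb, hd, hq]
    field_simp
    ring
  have hvar : 1 + 2 * a * (h * ρ / (ρ + 1)) = ρ * (S * c + C * s) / ((ρ + 1) * S) := by
    rw [ha]
    field_simp
    ring
  have hpos : 0 < ρ * (S * c + C * s) / ((ρ + 1) * S) := by positivity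
  simp only [hexp, ENNReal.ofReal_mul (Real.sqrt_nonneg _)]
  rw [lintegral_const_mul _ (by fun_prop),
    lintegral_exp_quadratic_gaussianReal (by positivity) (by rwa [hvar]), hvar,
    ← ENNReal.ofReal_mul (Real.sqrt_nonneg _), ← ENNReal.ofReal_mul (Real.sqrt_nonneg _)]
  congr 1
  rw [mul_div_assoc', mul_div_right_comm, ← Real.sqrt_div (by positivity)]
  congr 1
  · congr 1
    field_simp
  · congr 1
    rw [← sub_eq_zero]
    calc _ = 1 / (2 * h) * (y ^ 2 * S / (S * c + C * s) * (s ^ 2 + 1 - c ^ 2) +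
          m ^ 2 * s ^ 2 / (S * (S * c + C * s)) * (S ^ 2 + 1 - C ^ 2)) := by
          rw [hb, hd, hq]
          field_simp
          ring
      _ = 0 := by rw [hc, hCS]; ring

lemma ProbabilityTheory.IndepFun.lintegral_comp_prodMk {Ω α β : Type*} [MeasurableSpace Ω]
    [MeasurableSpace α] [MeasurableSpace β] {P : Measure Ω} [IsFiniteMeasure P] {X : Ω → α}
    {Y : Ω → β} (h : IndepFun X Y P) (hX : Measurable X) (hY : Measurable Y) {F : α × β → ℝ≥0∞}
    (hF : Measurable F) :
    ∫⁻ ω, F (X ω, Y ω) ∂P = ∫⁻ ω, ∫⁻ y, F (X ω, y) ∂(P.map Y) ∂P := by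
  rw [← lintegral_map (f := F) (g := fun ω ↦ (X ω, Y ω)) hF (hX.prodMk hY),
    (indepFun_iff_map_prod_eq_prod_map_map hX.aemeasurable hY.aemeasurable).1 h,
    lintegral_prod _ hF.aemeasurable, lintegral_map hF.lintegral_prod_right' hX]

namespace IsStdBM

variable {Ω : Type*} [MeasurableSpace Ω] {P : Measure Ω} {W : ℝ → Ω → ℝ}

lemma lintegral_mehlerRatio_bridge_succ [IsProbabilityMeasure P] (hW : IsStdBM P W)
    {φ : ℝ} (hφ : 0 < φ) (m : ℝ) {n k r : ℕ} (hr : 0 < r) (hn : k + (r + 1) = n) :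
    ∫⁻ ω, ENNReal.ofReal (Real.exp (-((Real.cosh φ - 1) / (2 * (1 / n))) *
        ∑ j ∈ Finset.range (k + 1), ((m + bridge W (j / n) ω) ^ 2 +
          (m + bridge W ((j + 1 : ℕ) / n) ω) ^ 2)) *
        mehlerRatio φ (1 / n) m r (m + bridge W ((k + 1 : ℕ) / n) ω)) ∂P =
    ∫⁻ ω, ENNReal.ofReal (Real.exp (-((Real.cosh φ - 1) / (2 * (1 / n))) *
        ∑ j ∈ Finset.range k, ((m + bridge W (j / n) ω) ^ 2 +
          (m + bridge W ((j + 1 : ℕ) / n) ω) ^ 2)) *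
        mehlerRatio φ (1 / n) m (r + 1) (m + bridge W (k / n) ω)) ∂P := by
  have hnk : (n : ℝ) = k + (r + 1) := by rw [← hn]; push_cast; ring
  have hn0 : (0 : ℝ) < n := by rw [hnk]; positivity
  have hr0 : (0 : ℝ) < r := Nat.cast_pos.2 hr
  have hs1 : (k / n : ℝ) < 1 := by rw [div_lt_one hn0]; linarith
  have ht1 : ((k + 1 : ℕ) / n : ℝ) ≤ 1 := by rw [div_le_one hn0]; push_cast; linarith
  have hst : (k / n : ℝ) ≤ (k + 1 : ℕ) / n := by gcongr; simp
  have hratio : (1 - ((k + 1 : ℕ) / n : ℝ)) / (1 - k / n) = r / (r + 1) := by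
    rw [one_sub_div hn0.ne', one_sub_div hn0.ne', div_div_div_cancel_right₀ hn0.ne', hnk]
    push_cast
    congr 1 <;> ring
  have hlaw := hW.map_bridge_innovation (by positivity) hst ht1 hs1
  have hindep := hW.indepFun_bridge_innovation (fun i : ℕ ↦ (min i k : ℕ) / (n : ℝ))
    (fun i ↦ by positivity) (fun i ↦ by gcongr; exact min_le_right _ _) (by positivity) hst ht1 hs1
  rw [mul_div_assoc, hratio] at hlaw
  rw [hratio] at hindep
  have hvar : (((k + 1 : ℕ) / n : ℝ) - k / n) * (r / (r + 1)) = 1 / n * r / (r + 1) := by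
    push_cast
    ring
  rw [hvar] at hlaw
  set κ := (Real.cosh φ - 1) / (2 * (1 / (n : ℝ))) with hκ
  let F : (ℕ → ℝ) × ℝ → ℝ≥0∞ := fun p ↦
    ENNReal.ofReal (Real.exp (-κ * ∑ j ∈ Finset.range k,
      ((m + p.1 j) ^ 2 + (m + p.1 (j + 1)) ^ 2))) *
    ENNReal.ofReal (Real.exp (-κ * ((m + p.1 k) ^ 2 +
      (m + r / (r + 1) * (m + p.1 k - m) + p.2) ^ 2)) *
      mehlerRatio φ (1 / n) m r (m + r / (r + 1) * (m + p.1 k - m) + p.2))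
  have hF : Measurable F := by fun_prop
  have hX : Measurable fun ω (i : ℕ) ↦ bridge W ((min i k : ℕ) / (n : ℝ)) ω :=
    measurable_pi_lambda _ fun i ↦ hW.measurable_bridge _
  have hY : Measurable fun ω ↦ bridge W ((k + 1 : ℕ) / n) ω - r / (r + 1) * bridge W (k / n) ω :=
    (hW.measurable_bridge _).sub ((hW.measurable_bridge _).const_mul _)
  have hsum (ω : Ω) : ∑ j ∈ Finset.range k, ((m + bridge W ((min j k : ℕ) / n) ω) ^ 2 +
        (m + bridge W ((min (j + 1) k : ℕ) / n) ω) ^ 2) =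
      ∑ j ∈ Finset.range k, ((m + bridge W (j / n) ω) ^ 2 +
        (m + bridge W ((j + 1 : ℕ) / n) ω) ^ 2) := by
    refine Finset.sum_congr rfl fun j hj ↦ ?_
    have := Finset.mem_range.1 hj
    rw [min_eq_left this.le, min_eq_left (by omega : j + 1 ≤ k)]
  have key := hindep.lintegral_comp_prodMk hX hY hF
  rw [hlaw] at key
  simp only [F, hsum, min_self] at key
  convert key using 3 with ω ω
  · have : m + r / (r + 1) * (m + bridge W (k / n) ω - m) + (bridge W ((k + 1 : ℕ) / n) ω -
        r / (r + 1) * bridge W (k / n) ω) = m + bridge W ((k + 1 : ℕ) / n) ω := by ring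
    rw [this, ← ENNReal.ofReal_mul (Real.exp_nonneg _), ← mul_assoc, ← Real.exp_add,
      Finset.sum_range_succ, mul_add]
  · rw [lintegral_const_mul _ (by fun_prop), lintegral_mehlerRatio hφ (by positivity) m _ hr,
      ← ENNReal.ofReal_mul (Real.exp_nonneg _)]

lemma lintegral_mehlerRatio_bridge [IsProbabilityMeasure P] (hW : IsStdBM P W)
    {φ : ℝ} (hφ : 0 < φ) (m : ℝ) {n : ℕ} (k r : ℕ) (hr : 0 < r) (hn : k + r = n) :
    ∫⁻ ω, ENNReal.ofReal (Real.exp (-((Real.cosh φ - 1) / (2 * (1 / n))) *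
        ∑ j ∈ Finset.range k, ((m + bridge W (j / n) ω) ^ 2 +
          (m + bridge W ((j + 1 : ℕ) / n) ω) ^ 2)) *
        mehlerRatio φ (1 / n) m r (m + bridge W (k / n) ω)) ∂P =
      ENNReal.ofReal (mehlerRatio φ (1 / n) m n m) := by
  induction k generalizing r with
  | zero =>
    obtain rfl : r = n := by omega
    have h0 (ω : Ω) : bridge W 0 ω = 0 := by simp [bridge, hW.2.2.1]
    simp [h0]
  | succ k ih =>
    rw [hW.lintegral_mehlerRatio_bridge_succ hφ m hr (by omega)]
    exact ih (r + 1) (by omega) (by omega)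

lemma measurable_exp_neg_sum_bridge_sq (hW : IsStdBM P W) (a m : ℝ) (n : ℕ) :
    Measurable fun ω ↦ Real.exp (-(a *
      ∑ j ∈ Finset.range n, (m + bridge W (j / n) ω) ^ 2)) := by
  have hm : Measurable fun ω ↦ ∑ j ∈ Finset.range n, (m + bridge W (j / n) ω) ^ 2 :=
    Finset.measurable_sum _ fun j _ ↦ ((hW.measurable_bridge _).const_add m).pow_const 2
  fun_prop

/-- Laplace functional of the discretized squared norm of a shifted Brownian bridge. -/
lemma integral_exp_neg_sum_bridge_sq [IsProbabilityMeasure P] (hW : IsStdBM P W)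
    {φ : ℝ} (hφ : 0 < φ) (m : ℝ) {n : ℕ} (hn : 0 < n) :
    ∫ ω, Real.exp (-(n * (Real.cosh φ - 1) *
        ∑ j ∈ Finset.range n, (m + bridge W (j / n) ω) ^ 2)) ∂P =
      √(n * Real.sinh φ / Real.sinh (n * φ)) * Real.exp (-(n * Real.sinh φ * m ^ 2 *
        (Real.cosh (n * φ) - 1) / Real.sinh (n * φ))) := by
  have hn0 : (n : ℝ) ≠ 0 := by positivity
  have h0 (ω : Ω) : bridge W 0 ω = 0 := by simp [bridge, hW.2.2.1]
  have h1 (ω : Ω) : bridge W 1 ω = 0 := by simp [bridge]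
  obtain ⟨k, rfl⟩ : ∃ k, n = k + 1 := ⟨n - 1, by omega⟩
  have key := hW.lintegral_mehlerRatio_bridge hφ m k 1 one_pos rfl
  have hsum (ω : Ω) : ∑ j ∈ Finset.range (k + 1), ((m + bridge W (j / (k + 1 : ℕ)) ω) ^ 2 +
        (m + bridge W ((j + 1 : ℕ) / (k + 1 : ℕ)) ω) ^ 2) =
      2 * ∑ j ∈ Finset.range (k + 1), (m + bridge W (j / (k + 1 : ℕ)) ω) ^ 2 := by
    have h2 := Finset.sum_range_succ' (fun j : ℕ ↦ (m + bridge W (j / (k + 1 : ℕ)) ω) ^ 2) (k + 1)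
    rw [Finset.sum_range_succ, div_self hn0, h1, Nat.cast_zero, zero_div, h0,
      add_left_inj] at h2
    rw [Finset.sum_add_distrib, ← h2, two_mul]
  rw [integral_eq_lintegral_of_nonneg_ae (ae_of_all _ fun _ ↦ Real.exp_nonneg _)
    (hW.measurable_exp_neg_sum_bridge_sq _ m _).aestronglyMeasurable]
  calc _ = (ENNReal.ofReal (mehlerRatio φ (1 / (k + 1 : ℕ)) m (k + 1) m)).toReal := by
        rw [← key]
        congr 1
        refine lintegral_congr fun ω ↦ ?_
        rw [mehlerRatio_one hφ (by positivity), ← Real.exp_add, ← mul_add]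
        have hlast : (m + bridge W (k / (k + 1 : ℕ)) ω) ^ 2 + m ^ 2 =
            (m + bridge W (k / (k + 1 : ℕ)) ω) ^ 2 +
              (m + bridge W ((k + 1 : ℕ) / (k + 1 : ℕ)) ω) ^ 2 := by
          rw [div_self hn0, h1, add_zero]
        rw [hlast, ← Finset.sum_range_succ, hsum]
        congr 2
        field_simp
    _ = _ := by
        rw [ENNReal.toReal_ofReal (mehlerRatio_nonneg _ _ _ _ _), mehlerRatio]
        congr 2
        field_simp
        ring

end IsStdBM

lemma tendsto_riemannSum_of_continuousOn {f : ℝ → ℝ} (hf : ContinuousOn f (Set.Icc 0 1)) :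
    Tendsto (fun n : ℕ ↦ (1 / n : ℝ) * ∑ j ∈ Finset.range n, f (j / n)) atTop
      (nhds (∫ u in (0 : ℝ)..1, f u)) := by
  rw [Metric.tendsto_atTop]
  intro ε hε
  obtain ⟨δ, hδ, hδf⟩ := Metric.uniformContinuousOn_iff.1
    (isCompact_Icc.uniformContinuousOn_of_continuous hf) (ε / 2) (half_pos hε)
  obtain ⟨N, hN⟩ := exists_nat_gt (1 / δ)
  refine ⟨N + 1, fun n hn ↦ ?_⟩
  have hn0 : (0 : ℝ) < n := Nat.cast_pos.2 (by omega)
  have hnδ : 1 / (n : ℝ) < δ := by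
    rw [one_div_lt hn0 hδ]
    exact hN.trans_le (Nat.cast_le.2 (by omega))
  have hmono (j : ℕ) : (j / n : ℝ) ≤ (j + 1 : ℕ) / n := by gcongr; simp
  have hsub {j : ℕ} (hj : j < n) : Set.Icc (j / n : ℝ) ((j + 1 : ℕ) / n) ⊆ Set.Icc 0 1 := by
    refine Set.Icc_subset_Icc (by positivity) ?_
    rw [div_le_one hn0]
    exact_mod_cast hj
  have hint {j : ℕ} (hj : j < n) :
      IntervalIntegrable f volume (j / n : ℝ) ((j + 1 : ℕ) / n) :=
    (hf.mono (by rw [Set.uIcc_of_le (hmono j)]; exact hsub hj)).intervalIntegrable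
  have hsum : ∫ u in (0 : ℝ)..1, f u =
      ∑ j ∈ Finset.range n, ∫ u in (j / n : ℝ)..((j + 1 : ℕ) / n), f u := by
    rw [intervalIntegral.sum_integral_adjacent_intervals (a := fun j : ℕ ↦ (j / n : ℝ))
      fun j hj ↦ hint hj]
    simp [hn0.ne']
  have hlen (j : ℕ) : ((j + 1 : ℕ) / n - j / n : ℝ) = 1 / n := by push_cast; ring
  have hterm {j : ℕ} (hj : j < n) :
      ‖1 / n * f (j / n) - ∫ u in (j / n : ℝ)..((j + 1 : ℕ) / n), f u‖ ≤ ε / 2 * (1 / n) := by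
    have h1 : 1 / n * f (j / n) - ∫ u in (j / n : ℝ)..((j + 1 : ℕ) / n), f u =
        ∫ u in (j / n : ℝ)..((j + 1 : ℕ) / n), (f (j / n) - f u) := by
      rw [intervalIntegral.integral_sub (by simp) (hint hj), intervalIntegral.integral_const,
        hlen, smul_eq_mul]
    rw [h1]
    refine (intervalIntegral.norm_integral_le_of_norm_le_const (C := ε / 2) fun u hu ↦ ?_).trans
      (by rw [hlen, abs_of_pos (by positivity)])
    rw [Set.uIoc_of_le (hmono j)] at hu
    rw [← dist_eq_norm]
    refine (hδf _ (hsub hj ⟨le_rfl, hmono j⟩) _ (hsub hj ⟨hu.1.le, hu.2⟩) ?_).le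
    rw [Real.dist_eq, abs_sub_comm, abs_of_nonneg (by linarith [hu.1])]
    linarith [hu.2, hlen j]
  rw [hsum, Finset.mul_sum, dist_eq_norm, ← Finset.sum_sub_distrib]
  calc _ ≤ ∑ j ∈ Finset.range n, ε / 2 * (1 / n : ℝ) :=
        norm_sum_le_of_le _ fun j hj ↦ hterm (Finset.mem_range.1 hj)
    _ = ε / 2 := by
        rw [Finset.sum_const, Finset.card_range, nsmul_eq_mul]
        field_simp
    _ < ε := half_lt_self hε

lemma tendsto_nat_mul_sinh_div (θ : ℝ) :
    Tendsto (fun n : ℕ ↦ n * Real.sinh (θ / n)) atTop (nhds θ) := by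
  have hd : HasDerivAt (fun x ↦ Real.sinh (θ * x)) θ 0 := by
    simpa using ((hasDerivAt_id (0 : ℝ)).const_mul θ).sinh
  have hlim : Tendsto (fun n : ℕ ↦ ((n : ℝ))⁻¹) atTop (nhdsWithin 0 {0}ᶜ) := by
    refine tendsto_nhdsWithin_iff.2 ⟨tendsto_inv_atTop_nhds_zero_nat, ?_⟩
    filter_upwards [eventually_gt_atTop 0] with n hn
    simp [hn.ne']
  refine (hd.tendsto_slope_zero.comp hlim).congr fun n ↦ ?_
  simp [div_eq_mul_inv]

lemma tendsto_nat_sq_mul_cosh_div_sub_one (θ : ℝ) :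
    Tendsto (fun n : ℕ ↦ (n : ℝ) ^ 2 * (Real.cosh (θ / n) - 1)) atTop (nhds (θ ^ 2 / 2)) := by
  have h := ((tendsto_nat_mul_sinh_div (θ / 2)).pow 2).const_mul 2
  rw [show 2 * (θ / 2) ^ 2 = θ ^ 2 / 2 by ring] at h
  refine h.congr fun n ↦ ?_
  have h2 := Real.cosh_two_mul (θ / 2 / n)
  rw [Real.cosh_sq, show 2 * (θ / 2 / n) = θ / n by ring] at h2
  rw [h2]
  ring

/-- Laplace functional of the squared norm of a Brownian bridge from `m` to `m`. -/
lemma IsStdBM.integral_exp_neg_integral_bridge_sq {Ω : Type*} [MeasurableSpace Ω] {P : Measure Ω}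
    [IsProbabilityMeasure P] {W : ℝ → Ω → ℝ} (hW : IsStdBM P W) {θ : ℝ} (hθ : 0 < θ) (m : ℝ) :
    ∫ ω, Real.exp (-(θ ^ 2 / 2 * ∫ u in (0 : ℝ)..1, (m + bridge W u ω) ^ 2)) ∂P =
      √(θ / Real.sinh θ) *
        Real.exp (-(θ * m ^ 2 * (Real.cosh θ - 1) / Real.sinh θ)) := by
  have hcont (ω : Ω) : ContinuousOn (fun u ↦ (m + bridge W u ω) ^ 2) (Set.Icc 0 1) := by
    have : ContinuousOn (fun u ↦ W u ω) (Set.Icc 0 1) :=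
      (hW.2.1 ω).mono Set.Icc_subset_Ici_self
    unfold bridge
    fun_prop
  have hleft : Tendsto (fun n : ℕ ↦ ∫ ω, Real.exp (-(n * (Real.cosh (θ / n) - 1) *
      ∑ j ∈ Finset.range n, (m + bridge W (j / n) ω) ^ 2)) ∂P) atTop
      (nhds (∫ ω, Real.exp (-(θ ^ 2 / 2 * ∫ u in (0 : ℝ)..1, (m + bridge W u ω) ^ 2)) ∂P)) := by
    refine tendsto_integral_of_dominated_convergence (fun _ ↦ 1)
      (fun n ↦ (hW.measurable_exp_neg_sum_bridge_sq _ m n).aestronglyMeasurable)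
      (integrable_const 1) (fun n ↦ ae_of_all _ fun ω ↦ ?_) (ae_of_all _ fun ω ↦ ?_)
    · rw [Real.norm_eq_abs, Real.abs_exp, Real.exp_le_one_iff, neg_nonpos]
      have := Real.one_le_cosh (θ / n)
      exact mul_nonneg (mul_nonneg n.cast_nonneg (by linarith))
        (Finset.sum_nonneg fun j _ ↦ sq_nonneg _)
    · refine (Real.continuous_exp.tendsto _).comp (Tendsto.neg ?_)
      refine ((tendsto_nat_sq_mul_cosh_div_sub_one θ).mul
        (tendsto_riemannSum_of_continuousOn (hcont ω))).congr' ?_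
      filter_upwards [eventually_gt_atTop 0] with n hn
      field_simp
  have hright : Tendsto (fun n : ℕ ↦ √(n * Real.sinh (θ / n) / Real.sinh θ) *
      Real.exp (-(n * Real.sinh (θ / n) * m ^ 2 * (Real.cosh θ - 1) / Real.sinh θ))) atTop
      (nhds (√(θ / Real.sinh θ) *
        Real.exp (-(θ * m ^ 2 * (Real.cosh θ - 1) / Real.sinh θ)))) := by
    have hg : Continuous fun x : ℝ ↦ √(x / Real.sinh θ) *
        Real.exp (-(x * m ^ 2 * (Real.cosh θ - 1) / Real.sinh θ)) := by fun_prop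
    exact (hg.tendsto θ).comp (tendsto_nat_mul_sinh_div θ)
  refine tendsto_nhds_unique (hleft.congr' ?_) hright
  filter_upwards [eventually_gt_atTop 0] with n hn
  have hn0 : (n : ℝ) ≠ 0 := by positivity
  rw [hW.integral_exp_neg_sum_bridge_sq (by positivity) m hn, mul_div_cancel₀ θ hn0]

theorem stmt_7 {Ω : Type*} [MeasurableSpace Ω] (P : Measure Ω) [IsProbabilityMeasure P]
    (W : ℝ → Ω → ℝ) (hW : IsStdBM P W)
    (B : ℝ → Ω → ℝ) (hB : ∀ t ω, B t ω = W t ω - t * W 1 ω)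
    (θ z : ℝ) (hθ : 0 < θ) :
    ∫ ω, Real.exp (-∫ u in (0:ℝ)..1, ((θ ^ 2 / 2) * (B u ω) ^ 2 + z * B u ω)) ∂P
      = Real.sqrt (θ / Real.sinh θ) *
        Real.exp (-(z ^ 2 / (2 * θ ^ 2)) *
          (2 * (Real.cosh θ - 1) / (θ * Real.sinh θ) - 1)) := by
  obtain rfl : B = bridge W := by
    ext t ω
    exact hB t ω
  have hint (ω : Ω) : IntervalIntegrable
      (fun u ↦ θ ^ 2 / 2 * (z / θ ^ 2 + bridge W u ω) ^ 2) volume 0 1 := by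
    refine ContinuousOn.intervalIntegrable ?_
    have : ContinuousOn (fun u ↦ W u ω) (Set.uIcc 0 1) :=
      (hW.2.1 ω).mono (by rw [Set.uIcc_of_le zero_le_one]; exact Set.Icc_subset_Ici_self)
    unfold bridge
    fun_prop
  have hsq (ω : Ω) : ∫ u in (0:ℝ)..1, ((θ ^ 2 / 2) * (bridge W u ω) ^ 2 + z * bridge W u ω) =
      θ ^ 2 / 2 * (∫ u in (0:ℝ)..1, (z / θ ^ 2 + bridge W u ω) ^ 2) - z ^ 2 / (2 * θ ^ 2) := by
    have (u : ℝ) : (θ ^ 2 / 2) * (bridge W u ω) ^ 2 + z * bridge W u ω =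
        θ ^ 2 / 2 * (z / θ ^ 2 + bridge W u ω) ^ 2 - z ^ 2 / (2 * θ ^ 2) := by
      field_simp
      ring
    simp_rw [this]
    rw [intervalIntegral.integral_sub (hint ω) (by simp), intervalIntegral.integral_const_mul]
    simp
  simp_rw [hsq, neg_sub, sub_eq_add_neg, Real.exp_add]
  rw [integral_const_mul, hW.integral_exp_neg_integral_bridge_sq hθ, mul_left_comm,
    ← Real.exp_add]
  have hS : Real.sinh θ ≠ 0 := (Real.sinh_pos_iff.2 hθ).ne'
  congr 2
  field_simp
  ring
end
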